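/- Let A be a free line arrangement in ℙ² consisting of d = |A| lines, which is not a pencil, and let m be the maximal multiplicity of an intersection point of A. If 2m ≥ d, then n₂ ≥ −2m² + (3d−1)m − d² + d, and moreover −2m² + (3d−1)m − d² + d ≥ d/2. -/

import Mathlib

open scoped LinearAlgebra.Projectivization

noncomputable section

attribute [local instance] Classical.propDecidable

/-- A point of the complex projective plane. -/
abbrev ProjPoint := ℙ ℂ (Fin 3 → ℂ)

/-- A line of the complex projective plane, encoded by a defining linear form
up to scalar, i.e. as a point of the dual projective plane. -/
abbrev ProjLine := ℙ ℂ (Module.Dual ℂ (Fin 3 → ℂ))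

/-- The incidence relation between points and lines of `ℙ²`. -/
def PointOnLine (p : ProjPoint) (L : ProjLine) : Prop :=
  L.rep p.rep = 0

/-- The multiplicity of a point with respect to a line arrangement:
the number of lines of the arrangement passing through the point. -/
def mult (A : Finset ProjLine) (p : ProjPoint) : ℕ :=
  Set.ncard {L : ProjLine | L ∈ A ∧ PointOnLine p L}

/-- An intersection point of a line arrangement: a point lying on at least two lines. -/
def IsIntersectionPoint (A : Finset ProjLine) (p : ProjPoint) : Prop :=
  2 ≤ mult A p

/-- A modular point: an intersection point `p` such that for any other intersection
point `q`, the line through `p` and `q` belongs to the arrangement. -/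
def IsModular (A : Finset ProjLine) (p : ProjPoint) : Prop :=
  IsIntersectionPoint A p ∧
    ∀ q : ProjPoint, IsIntersectionPoint A q → q ≠ p →
      ∃ L ∈ A, PointOnLine p L ∧ PointOnLine q L

/-- A supersolvable line arrangement: one possessing a modular point. -/
def IsSupersolvable (A : Finset ProjLine) : Prop :=
  ∃ p, IsModular A p

/-- An `m`-homogeneous supersolvable line arrangement: supersolvable, and all
modular points have multiplicity `m`. -/
def IsHomogSS (A : Finset ProjLine) (m : ℕ) : Prop :=
  IsSupersolvable A ∧ ∀ p, IsModular A p → mult A p = m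

/-- `nk A k` is the number of intersection points of multiplicity `k` of `A`. -/
def nk (A : Finset ProjLine) (k : ℕ) : ℕ :=
  Set.ncard {p : ProjPoint | IsIntersectionPoint A p ∧ mult A p = k}

/-- A pencil: all lines pass through a common point. -/
def IsPencil (A : Finset ProjLine) : Prop :=
  ∃ p, ∀ L ∈ A, PointOnLine p L

abbrev S3 := MvPolynomial (Fin 3) ℂ

/-- The degree-one polynomial in `ℂ[x,y,z]` associated to a linear form on `ℂ³`. -/
def formToPoly (φ : Module.Dual ℂ (Fin 3 → ℂ)) : S3 :=
  ∑ i : Fin 3, MvPolynomial.C (φ (Pi.single i 1)) * MvPolynomial.X i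

/-- A defining linear equation (in `ℂ[x,y,z]`) of (the cone over) a projective line. -/
def linePoly (L : ProjLine) : S3 := formToPoly L.rep

/-- The module `D(A)` of logarithmic derivations of a line arrangement, viewed as a
central plane arrangement in `ℂ³`. -/
def logDer (A : Finset ProjLine) : Submodule S3 (Derivation ℂ S3 S3) where
  carrier := {θ | ∀ L ∈ A, θ (linePoly L) ∈ Ideal.span {linePoly L}}
  add_mem' := by
    intro θ₁ θ₂ h₁ h₂ L hL
    simpa using Ideal.add_mem _ (h₁ L hL) (h₂ L hL)
  zero_mem' := by
    intro L hL
    simp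
  smul_mem' := by
    intro c θ hθ L hL
    simpa using Ideal.mul_mem_left _ c (hθ L hL)

/-- A line arrangement is free if its module of logarithmic derivations is a free
(graded) module over the polynomial ring `S = ℂ[x,y,z]`. -/
def IsFreeArr (A : Finset ProjLine) : Prop :=
  Module.Free S3 (logDer A)

/-- Two lines have a common point. -/
lemma exists_common_point (L L' : ProjLine) :
    ∃ q : ProjPoint, PointOnLine q L ∧ PointOnLine q L' := by
  have h : LinearMap.ker (LinearMap.prod L.rep L'.rep) ≠ ⊥ :=
    LinearMap.ker_ne_bot_of_finrank_lt (by simp)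
  obtain ⟨v, hv, hv0⟩ := (Submodule.ne_bot_iff _).1 h
  have hv' : L.rep v = 0 ∧ L'.rep v = 0 := by
    simpa [LinearMap.mem_ker, Prod.ext_iff] using hv
  refine ⟨Projectivization.mk ℂ v hv0, ?_, ?_⟩
  all_goals
    obtain ⟨a, ha⟩ := Projectivization.exists_smul_eq_mk_rep ℂ v hv0
    unfold PointOnLine
    rw [← ha, Units.smul_def, map_smul]
    simp [hv'.1, hv'.2]

lemma span_pair_finrank {V : Type*} [AddCommGroup V] [Module ℂ V] {a b : ℙ ℂ V} (h : a ≠ b) :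
    Module.finrank ℂ (Submodule.span ℂ (Set.range (Projectivization.rep ∘ ![a, b]))) = 2 := by
  have h1 := (Projectivization.independent_pair_iff_ne a b).2 h
  rw [Projectivization.independent_iff] at h1
  simpa using finrank_span_eq_card h1

/-- Two distinct lines have at most one common point. -/
lemma common_point_unique {L L' : ProjLine} {q q' : ProjPoint} (hL : L ≠ L')
    (h1 : PointOnLine q L) (h2 : PointOnLine q L') (h3 : PointOnLine q' L)
    (h4 : PointOnLine q' L') : q = q' := by
  by_contra hq
  have e1 := span_pair_finrank hq
  have e2 := span_pair_finrank hL
  have e3 := Subspace.finrank_add_finrank_dualAnnihilator_eq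
    (Submodule.span ℂ (Set.range (Projectivization.rep ∘ ![q, q'])))
  have hle : Submodule.span ℂ (Set.range (Projectivization.rep ∘ ![L, L'])) ≤
      (Submodule.span ℂ (Set.range (Projectivization.rep ∘ ![q, q']))).dualAnnihilator := by
    rw [Submodule.span_le]
    rintro _ ⟨i, rfl⟩
    rw [SetLike.mem_coe, Submodule.mem_dualAnnihilator]
    intro w hw
    induction hw using Submodule.span_induction with
    | mem x hx =>
      obtain ⟨j, rfl⟩ := hx
      unfold PointOnLine at h1 h2 h3 h4
      fin_cases i <;> fin_cases j <;> simp [h1, h2, h3, h4]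
    | zero => simp
    | add x y _ _ hx hy => rw [map_add, hx, hy, add_zero]
    | smul a x _ hx => rw [map_smul, hx, smul_zero]
  have := Submodule.finrank_mono hle
  simp only [Module.finrank_fintype_fun_eq_card, Fintype.card_fin] at e3
  omega

/-- The chosen common point of two lines. -/
def interPt (L L' : ProjLine) : ProjPoint := (exists_common_point L L').choose

lemma interPt_left (L L' : ProjLine) : PointOnLine (interPt L L') L :=
  (exists_common_point L L').choose_spec.1

lemma interPt_right (L L' : ProjLine) : PointOnLine (interPt L L') L' :=
  (exists_common_point L L').choose_spec.2

lemma mult_eq_card (A : Finset ProjLine) (p : ProjPoint) :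
    mult A p = (A.filter (fun L => PointOnLine p L)).card := by
  unfold mult
  rw [← Set.ncard_coe_finset]
  congr 1
  ext L
  simp

lemma double_finite (A : Finset ProjLine) :
    {p : ProjPoint | IsIntersectionPoint A p ∧ mult A p = 2}.Finite := by
  apply ((A ×ˢ A).image (fun x => interPt x.1 x.2)).finite_toSet.subset
  rintro q ⟨hq, -⟩
  unfold IsIntersectionPoint at hq
  rw [mult_eq_card] at hq
  obtain ⟨L, hL, L', hL', hne⟩ := Finset.one_lt_card.1 hq
  rw [Finset.mem_filter] at hL hL'
  simp only [Finset.coe_image, Set.mem_image, Finset.mem_coe, Finset.mem_product]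
  have heq := common_point_unique hne (interPt_left _ _) (interPt_right _ _) hL.2 hL'.2
  exact ⟨(L, L'), ⟨hL.1, hL'.1⟩, heq⟩

/-- The combinatorial bound: valid for every arrangement and every point. -/
lemma n2_count (A : Finset ProjLine) (p : ProjPoint) :
    (A.filter (fun L => ¬ PointOnLine p L)).card * (A.filter (fun L => PointOnLine p L)).card ≤
      nk A 2 + (A.filter (fun L => ¬ PointOnLine p L)).card *
        ((A.filter (fun L => ¬ PointOnLine p L)).card - 1) := by
  set P := A.filter (fun L => PointOnLine p L) with hP
  set Q := A.filter (fun L => ¬ PointOnLine p L) with hQ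
  have hne : ∀ H ∈ Q, ∀ L ∈ P, H ≠ L := by
    rintro H hH L hL rfl
    exact (Finset.mem_filter.1 hH).2 (Finset.mem_filter.1 hL).2
  rw [← Finset.card_product,
    ← Finset.card_filter_add_card_filter_not (fun x => mult A (interPt x.1 x.2) = 2)]
  apply Nat.add_le_add
  · unfold nk
    rw [← Set.ncard_coe_finset]
    refine Set.ncard_le_ncard_of_injOn (fun x => interPt x.1 x.2) ?_ ?_ (double_finite A)
    · intro x hx
      have hx2 := (Finset.mem_filter.1 (Finset.mem_coe.1 hx)).2
      exact ⟨hx2.ge, hx2⟩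
    · rintro ⟨H, L⟩ hx ⟨H', L'⟩ hx' heq
      simp only [Finset.coe_filter, Finset.mem_product, Set.mem_ofPred_eq] at hx hx' heq
      obtain ⟨⟨hH, hL⟩, hm⟩ := hx
      obtain ⟨⟨hH', hL'⟩, -⟩ := hx'
      have key : ∀ a b c : ProjLine, a ∈ A → b ∈ A → c ∈ A → PointOnLine (interPt H L) a →
          PointOnLine (interPt H L) b → PointOnLine (interPt H L) c →
          a ≠ c → b ≠ c → a = b := by
        intro a b c ha hb hc ha' hb' hc' hac hbc
        by_contra hab
        rw [mult_eq_card] at hm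
        have hsub : ({a, b, c} : Finset ProjLine) ⊆
            A.filter (fun K => PointOnLine (interPt H L) K) := by
          intro K hK
          simp only [Finset.mem_insert, Finset.mem_singleton] at hK
          rw [Finset.mem_filter]
          rcases hK with rfl | rfl | rfl <;> exact ⟨by assumption, by assumption⟩
        have h3 := Finset.card_le_card hsub
        rw [Finset.card_eq_three.2 ⟨a, b, c, hab, hac, hbc, rfl⟩] at h3
        omega
      have iH := interPt_left H L
      have iL := interPt_right H L
      have iH' : PointOnLine (interPt H L) H' := heq ▸ interPt_left H' L'
      have iL' : PointOnLine (interPt H L) L' := heq ▸ interPt_right H' L'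
      have aH := (Finset.mem_filter.1 hH).1
      have aL := (Finset.mem_filter.1 hL).1
      have aH' := (Finset.mem_filter.1 hH').1
      have aL' := (Finset.mem_filter.1 hL').1
      have e1 : H = H' := key H H' L aH aH' aL iH iH' iL (hne _ hH _ hL) (hne _ hH' _ hL)
      have e2 : L = L' := key L L' H aL aL' aH iL iL' iH (hne _ hH _ hL).symm
        (hne _ hH _ hL').symm
      rw [e1, e2]
  · have hfib : ((Q ×ˢ P).filter (fun x => ¬ mult A (interPt x.1 x.2) = 2)).card =
        ∑ H ∈ Q, (P.filter (fun L => ¬ mult A (interPt H L) = 2)).card := by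
      rw [Finset.card_filter, Finset.sum_product]
      simp only [Finset.card_filter]
    rw [hfib, ← smul_eq_mul]
    apply Finset.sum_le_card_nsmul
    intro H hH
    rw [← Finset.card_erase_of_mem hH]
    have hthird : ∀ L ∈ P.filter (fun L => ¬ mult A (interPt H L) = 2),
        ∃ H' ∈ Q.erase H, PointOnLine (interPt H L) H' := by
      intro L hL
      obtain ⟨hL, hm⟩ := Finset.mem_filter.1 hL
      have aH := Finset.mem_filter.1 hH
      have aL := Finset.mem_filter.1 hL
      by_contra hcon
      push Not at hcon
      apply hm
      rw [mult_eq_card, ← Finset.card_pair (hne _ hH _ hL)]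
      congr 1
      ext K
      rw [Finset.mem_filter, Finset.mem_insert, Finset.mem_singleton]
      constructor
      · rintro ⟨hK, hK'⟩
        by_contra hKne
        push Not at hKne
        by_cases hKp : PointOnLine p K
        · have := common_point_unique hKne.2 hK' (interPt_right H L) hKp aL.2
          exact aH.2 (this ▸ interPt_left H L)
        · exact hcon K (Finset.mem_erase.2 ⟨hKne.1, Finset.mem_filter.2 ⟨hK, hKp⟩⟩) hK'
      · rintro (rfl | rfl)
        · exact ⟨aH.1, interPt_left _ _⟩
        · exact ⟨aL.1, interPt_right _ _⟩
    choose! f hf hf' using hthird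
    refine Finset.card_le_card_of_injOn f (fun L hL => hf L hL) ?_
    intro L hL L' hL' heq
    by_contra hLL
    have hL := Finset.mem_coe.1 hL
    have hL' := Finset.mem_coe.1 hL'
    have hne2 : f L ≠ H := (Finset.mem_erase.1 (hf L hL)).1
    have hq : interPt H L = interPt H L' :=
      common_point_unique hne2 (hf' L hL) (interPt_left _ _) (heq ▸ hf' L' hL') (interPt_left _ _)
    have hp := common_point_unique hLL (interPt_right H L) (hq ▸ interPt_right H L')
      (Finset.mem_filter.1 (Finset.mem_filter.1 hL).1).2
      (Finset.mem_filter.1 (Finset.mem_filter.1 hL').1).2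
    exact (Finset.mem_filter.1 hH).2 (hp ▸ interPt_left H L)

/-- Let `A` be a free line arrangement with `d` lines, not a pencil,
and let `m` be the maximal multiplicity of an intersection point of `A`. If `2m ≥ d`
then `n₂ ≥ -2m² + (3d-1)m - d² + d ≥ d/2`. -/
theorem n2_bound_of_free (A : Finset ProjLine) (m : ℕ)
    (hfree : IsFreeArr A) (hpencil : ¬ IsPencil A)
    (hex : ∃ p : ProjPoint, IsIntersectionPoint A p ∧ mult A p = m)
    (hub : ∀ p : ProjPoint, IsIntersectionPoint A p → mult A p ≤ m)
    (hd : (A.card : ℝ) ≤ 2 * m) :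
    (-2 * (m : ℝ) ^ 2 + (3 * (A.card : ℝ) - 1) * m - (A.card : ℝ) ^ 2 + A.card
        ≤ (nk A 2 : ℝ)) ∧
    ((A.card : ℝ) / 2
        ≤ -2 * (m : ℝ) ^ 2 + (3 * (A.card : ℝ) - 1) * m - (A.card : ℝ) ^ 2 + A.card) := by
  obtain ⟨p, -, hpm⟩ := hex
  have hcount := n2_count A p
  have hsum := Finset.card_filter_add_card_filter_not (s := A) (fun L => PointOnLine p L)
  have hpos : 1 ≤ (A.filter (fun L => ¬ PointOnLine p L)).card := by
    rw [Nat.one_le_iff_ne_zero, ← Nat.pos_iff_ne_zero, Finset.card_pos]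
    by_contra hemp
    rw [Finset.not_nonempty_iff_eq_empty, Finset.filter_eq_empty_iff] at hemp
    exact hpencil ⟨p, fun L hL => not_not.1 (hemp hL)⟩
  rw [mult_eq_card] at hpm
  rw [hpm] at hcount hsum
  generalize (A.filter (fun L => ¬ PointOnLine p L)).card = k at *
  obtain ⟨j, rfl⟩ := Nat.exists_eq_add_of_le hpos
  rw [← hsum] at hd ⊢
  rw [Nat.add_sub_cancel_left] at hcount
  have hcount' : (((1 + j) * m : ℕ) : ℝ) ≤ ((nk A 2 + (1 + j) * j : ℕ) : ℝ) := by
    exact_mod_cast hcount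
  push_cast at hcount' hd ⊢
  have hj : (0 : ℝ) ≤ j := Nat.cast_nonneg j
  constructor
  · nlinarith
  · have : (0 : ℝ) ≤ (m - (1 + j)) * (2 * (1 + j) - 1) :=
      mul_nonneg (by linarith) (by linarith)
    nlinarith

end
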